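/- Let ε > 0, T > 0, and let u, B : ℝ³ × [0,T] → ℝ³ and p : ℝ³ × [0,T] → ℝ be three times continuously differentiable. Suppose that for all (x, τ) ∈ ℝ³ × [0,T] the rescaled momentum equation ∂_τ u + √ε ∇p = √ε Δ u − √ε (u·∇)u − (√ε/2)(div u) u + √ε curl B × B and the rescaled constraint equation √ε ∂_τ p + div u = 0 hold pointwise. Then p satisfies the inhomogeneous wave equation ∂_{ττ} p − Δ p = −Δ(div u) + div( (u·∇)u + (1/2)(div u) u − curl B × B ) pointwise on ℝ³ × (0,T), where all spatial differential operators (∇, div, curl, Δ) act in the x variable. -/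

import Mathlib

/-- `∂_j g` at `x`: the `j`-th spatial partial derivative of a scalar function. -/
noncomputable def pd3 (g : (Fin 3 → ℝ) → ℝ) (x : Fin 3 → ℝ) (j : Fin 3) : ℝ :=
  fderiv ℝ g x (Pi.single j 1)

/-- The spatial Laplacian of a scalar function on `ℝ³` at `x`. -/
noncomputable def lap3 (g : (Fin 3 → ℝ) → ℝ) (x : Fin 3 → ℝ) : ℝ :=
  ∑ j, pd3 (fun y => pd3 g y j) x j

/-- The divergence of a vector field on `ℝ³` at `x`. -/
noncomputable def div3 (F : (Fin 3 → ℝ) → (Fin 3 → ℝ)) (x : Fin 3 → ℝ) : ℝ :=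
  ∑ j, pd3 (fun y => F y j) x j

/-- The curl of a vector field on `ℝ³` at `x` (with `0`-based indices). -/
noncomputable def curl3 (F : (Fin 3 → ℝ) → (Fin 3 → ℝ)) (x : Fin 3 → ℝ) : Fin 3 → ℝ :=
  ![pd3 (fun y => F y 2) x 1 - pd3 (fun y => F y 1) x 2,
    pd3 (fun y => F y 0) x 2 - pd3 (fun y => F y 2) x 0,
    pd3 (fun y => F y 1) x 0 - pd3 (fun y => F y 0) x 1]

/-- The convective term `((G·∇)F)_i = Σ_j G_j ∂_j F_i` at `x`. -/
noncomputable def advect3 (G F : (Fin 3 → ℝ) → (Fin 3 → ℝ)) (x : Fin 3 → ℝ) :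
    Fin 3 → ℝ :=
  fun i => ∑ j, G x j * pd3 (fun y => F y i) x j

/-- The derivative of a scalar function on space-time in the direction `v`. -/
noncomputable def dirDeriv (v : (Fin 3 → ℝ) × ℝ) (f : (Fin 3 → ℝ) × ℝ → ℝ)
    (q : (Fin 3 → ℝ) × ℝ) : ℝ :=
  fderiv ℝ f q v

/-- The `j`-th spatial unit vector of space-time. -/
noncomputable def spaceDir (j : Fin 3) : (Fin 3 → ℝ) × ℝ := (Pi.single j 1, 0)

lemma ContDiff.dirDeriv {m n : WithTop ℕ∞} {f : (Fin 3 → ℝ) × ℝ → ℝ} (hf : ContDiff ℝ n f)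
    (hmn : m + 1 ≤ n) (v : (Fin 3 → ℝ) × ℝ) : ContDiff ℝ m (dirDeriv v f) :=
  (hf.fderiv_right hmn).clm_apply contDiff_const

lemma dirDeriv_comm {f : (Fin 3 → ℝ) × ℝ → ℝ} (hf : ContDiff ℝ 2 f) (v w : (Fin 3 → ℝ) × ℝ) :
    dirDeriv v (dirDeriv w f) = dirDeriv w (dirDeriv v f) := by
  have hd : Differentiable ℝ (fderiv ℝ f) :=
    (hf.fderiv_right (m := 1) (by norm_num)).differentiable (by norm_num)
  have key (a b q : (Fin 3 → ℝ) × ℝ) :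
      dirDeriv a (dirDeriv b f) q = fderiv ℝ (fderiv ℝ f) q a b := by
    change fderiv ℝ (fun q => fderiv ℝ f q b) q a = _
    rw [fderiv_clm_apply (hd q) (differentiableAt_const b)]
    simp
  funext q
  rw [key, key]
  exact (hf.contDiffAt.isSymmSndFDerivAt (by simp)).eq v w

lemma dirDeriv_sum {ι : Type*} (s : Finset ι) (v : (Fin 3 → ℝ) × ℝ)
    {f : ι → (Fin 3 → ℝ) × ℝ → ℝ} (hf : ∀ i ∈ s, Differentiable ℝ (f i)) :
    dirDeriv v (fun q => ∑ i ∈ s, f i q) = fun q => ∑ i ∈ s, dirDeriv v (f i) q := by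
  funext q
  simp only [dirDeriv]
  rw [fderiv_fun_sum fun i hi => hf i hi q]
  simp

lemma dirDeriv_sub (v : (Fin 3 → ℝ) × ℝ) {f g : (Fin 3 → ℝ) × ℝ → ℝ}
    (hf : Differentiable ℝ f) (hg : Differentiable ℝ g) (q : (Fin 3 → ℝ) × ℝ) :
    dirDeriv v (fun q => f q - g q) q = dirDeriv v f q - dirDeriv v g q := by
  simp only [dirDeriv]
  rw [fderiv_fun_sub (hf q) (hg q)]
  rfl

lemma dirDeriv_const_mul (v : (Fin 3 → ℝ) × ℝ) {f : (Fin 3 → ℝ) × ℝ → ℝ}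
    (hf : Differentiable ℝ f) (c : ℝ) (q : (Fin 3 → ℝ) × ℝ) :
    dirDeriv v (fun q => c * f q) q = c * dirDeriv v f q := by
  simp only [dirDeriv]
  rw [fderiv_const_mul (hf q)]
  rfl

lemma pd3_slice {f : (Fin 3 → ℝ) × ℝ → ℝ} (hf : Differentiable ℝ f) (x : Fin 3 → ℝ) (τ : ℝ)
    (j : Fin 3) : pd3 (fun y => f (y, τ)) x j = dirDeriv (spaceDir j) f (x, τ) := by
  have h := HasFDerivAt.comp (f := fun y => (y, τ)) x (hf (x, τ)).hasFDerivAt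
    (hasFDerivAt_prodMk_left x τ)
  change fderiv ℝ (f ∘ fun y => (y, τ)) x _ = _
  rw [h.fderiv]
  simp [dirDeriv, spaceDir]

lemma deriv_slice {f : (Fin 3 → ℝ) × ℝ → ℝ} (hf : Differentiable ℝ f) (x : Fin 3 → ℝ) (τ : ℝ) :
    deriv (fun t => f (x, t)) τ = dirDeriv (0, 1) f (x, τ) := by
  have h := HasFDerivAt.comp (f := fun t => (x, t)) τ (hf (x, τ)).hasFDerivAt
    (hasFDerivAt_prodMk_right x τ)
  change deriv (f ∘ fun t => (x, t)) τ = _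
  rw [h.hasDerivAt.deriv]
  simp [dirDeriv]

lemma lap3_slice {f : (Fin 3 → ℝ) × ℝ → ℝ} (hf : ContDiff ℝ 2 f) (x : Fin 3 → ℝ) (τ : ℝ) :
    lap3 (fun y => f (y, τ)) x =
      ∑ j, dirDeriv (spaceDir j) (dirDeriv (spaceDir j) f) (x, τ) := by
  unfold lap3
  refine Finset.sum_congr rfl fun j _ => ?_
  simp only [pd3_slice (hf.differentiable two_ne_zero)]
  exact pd3_slice ((hf.dirDeriv (m := 1) (by norm_num) _).differentiable one_ne_zero) x τ j

/-- The acoustic wave equation (4.3) for the rescaled pressure: if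
`∂_τ u + √ε ∇p = √ε Δu − √ε (u·∇)u − (√ε/2)(div u) u + √ε curl B × B` and
`√ε ∂_τ p + div u = 0` hold pointwise on `ℝ³ × [0,T]`, then
`∂_{ττ} p − Δp = −Δ(div u) + div((u·∇)u + (1/2)(div u) u − curl B × B)`
pointwise on `ℝ³ × (0,T)`. -/
theorem wave_equation_for_pressure
    (ε T : ℝ) (hε : 0 < ε) (hT : 0 < T)
    (u B : (Fin 3 → ℝ) → ℝ → (Fin 3 → ℝ)) (p : (Fin 3 → ℝ) → ℝ → ℝ)
    (hu_reg : ContDiff ℝ 3 fun q : (Fin 3 → ℝ) × ℝ => u q.1 q.2)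
    (hB_reg : ContDiff ℝ 3 fun q : (Fin 3 → ℝ) × ℝ => B q.1 q.2)
    (hp_reg : ContDiff ℝ 3 fun q : (Fin 3 → ℝ) × ℝ => p q.1 q.2)
    (hmomentum : ∀ x : Fin 3 → ℝ, ∀ τ ∈ Set.Icc (0 : ℝ) T, ∀ i : Fin 3,
      deriv (fun t => u x t i) τ + Real.sqrt ε * pd3 (fun y => p y τ) x i =
        Real.sqrt ε * lap3 (fun y => u y τ i) x -
          Real.sqrt ε * advect3 (fun y => u y τ) (fun y => u y τ) x i -
          (Real.sqrt ε / 2) * div3 (fun y => u y τ) x * u x τ i +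
          Real.sqrt ε * crossProduct (curl3 (fun y => B y τ) x) (B x τ) i)
    (hconstraint : ∀ x : Fin 3 → ℝ, ∀ τ ∈ Set.Icc (0 : ℝ) T,
      Real.sqrt ε * deriv (fun t => p x t) τ + div3 (fun y => u y τ) x = 0) :
    ∀ x : Fin 3 → ℝ, ∀ τ ∈ Set.Ioo (0 : ℝ) T,
      deriv (fun t => deriv (fun s => p x s) t) τ - lap3 (fun y => p y τ) x =
        -lap3 (fun y => div3 (fun z => u z τ) y) x +
          div3 (fun y => fun i =>
            advect3 (fun z => u z τ) (fun z => u z τ) y i +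
              (1 / 2) * div3 (fun z => u z τ) y * u y τ i -
              crossProduct (curl3 (fun z => B z τ) y) (B y τ) i) x := by
  intro x τ hτ
  have hs : Real.sqrt ε ≠ 0 := (Real.sqrt_pos.2 hε).ne'
  set P : (Fin 3 → ℝ) × ℝ → ℝ := fun q => p q.1 q.2
  set U : Fin 3 → (Fin 3 → ℝ) × ℝ → ℝ := fun i q => u q.1 q.2 i
  have hU (i) : ContDiff ℝ 3 (U i) := contDiff_pi.1 hu_reg i
  have hU2 (i v) : ContDiff ℝ 2 (dirDeriv v (U i)) := (hU i).dirDeriv (by norm_num) v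
  have hU1 (i v w) : ContDiff ℝ 1 (dirDeriv w (dirDeriv v (U i))) :=
    (hU2 i v).dirDeriv (by norm_num) w
  have hP2 (v) : ContDiff ℝ 2 (dirDeriv v P) := hp_reg.dirDeriv (by norm_num) v
  have hdiv (y t) : div3 (fun z => u z t) y = ∑ i, dirDeriv (spaceDir i) (U i) (y, t) :=
    Finset.sum_congr rfl fun i _ => pd3_slice ((hU i).differentiable (by norm_num)) y t i
  have hcdiv : ContDiff ℝ 2 fun q => ∑ i, dirDeriv (spaceDir i) (U i) q :=
    ContDiff.sum fun i _ => hU2 i _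
  -- the second time derivative of the pressure, from the constraint
  have hptt : deriv (fun t => deriv (fun s => p x s) t) τ =
      -(Real.sqrt ε)⁻¹ * ∑ i, dirDeriv (0, 1) (dirDeriv (spaceDir i) (U i)) (x, τ) := by
    have hev : (fun t => deriv (fun s => p x s) t) =ᶠ[nhds τ]
        fun t => -(Real.sqrt ε)⁻¹ * ∑ i, dirDeriv (spaceDir i) (U i) (x, t) := by
      filter_upwards [Ioo_mem_nhds hτ.1 hτ.2] with t ht
      have h := hconstraint x t (Set.Ioo_subset_Icc_self ht)
      rw [hdiv] at h
      field_simp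
      linarith
    rw [hev.deriv_eq, deriv_const_mul_field,
      deriv_slice (hcdiv.differentiable two_ne_zero) x τ,
      dirDeriv_sum _ _ fun i _ => (hU2 i _).differentiable two_ne_zero]
  have hlapdiv : lap3 (fun y => div3 (fun z => u z τ) y) x =
      ∑ j, ∑ i, dirDeriv (spaceDir j) (dirDeriv (spaceDir j) (dirDeriv (spaceDir i) (U i)))
        (x, τ) := by
    simp only [hdiv]
    rw [lap3_slice hcdiv]
    refine Finset.sum_congr rfl fun j _ => ?_
    rw [dirDeriv_sum _ _ fun i _ => (hU2 i _).differentiable two_ne_zero,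
      dirDeriv_sum _ _ fun i _ => (hU1 i _ _).differentiable one_ne_zero]
  -- the nonlinear terms, expressed linearly through the momentum equation
  have hN (i : Fin 3) : (fun y => advect3 (fun z => u z τ) (fun z => u z τ) y i +
      (1 / 2) * div3 (fun z => u z τ) y * u y τ i -
      crossProduct (curl3 (fun z => B z τ) y) (B y τ) i) = fun y =>
      (fun q => ∑ j, dirDeriv (spaceDir j) (dirDeriv (spaceDir j) (U i)) q -
        (Real.sqrt ε)⁻¹ * dirDeriv (0, 1) (U i) q - dirDeriv (spaceDir i) P q) (y, τ) := by
    funext y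
    have h := hmomentum y τ (Set.Ioo_subset_Icc_self hτ) i
    have h1 : deriv (fun t => u y t i) τ = dirDeriv (0, 1) (U i) (y, τ) :=
      deriv_slice ((hU i).differentiable (by norm_num)) y τ
    have h2 : pd3 (fun y => p y τ) y i = dirDeriv (spaceDir i) P (y, τ) :=
      pd3_slice (hp_reg.differentiable (by norm_num)) y τ i
    have h3 : lap3 (fun y => u y τ i) y = _ :=
      lap3_slice ((hU i).of_le (by norm_num)) y τ
    rw [h1, h2, h3] at h
    beta_reduce
    field_simp
    linarith
  have hdivN (i : Fin 3) : pd3 (fun y => advect3 (fun z => u z τ) (fun z => u z τ) y i +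
      (1 / 2) * div3 (fun z => u z τ) y * u y τ i -
      crossProduct (curl3 (fun z => B z τ) y) (B y τ) i) x i =
      ∑ j, dirDeriv (spaceDir j) (dirDeriv (spaceDir j) (dirDeriv (spaceDir i) (U i))) (x, τ) -
        (Real.sqrt ε)⁻¹ * dirDeriv (0, 1) (dirDeriv (spaceDir i) (U i)) (x, τ) -
        dirDeriv (spaceDir i) (dirDeriv (spaceDir i) P) (x, τ) := by
    have d1 : Differentiable ℝ
        fun q => ∑ j, dirDeriv (spaceDir j) (dirDeriv (spaceDir j) (U i)) q :=
      Differentiable.fun_sum fun j _ => (hU1 i _ _).differentiable one_ne_zero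
    have d2 : Differentiable ℝ fun q => (Real.sqrt ε)⁻¹ * dirDeriv (0, 1) (U i) q :=
      ((hU2 i _).differentiable two_ne_zero).const_mul _
    have d3 : Differentiable ℝ (dirDeriv (spaceDir i) P) := (hP2 _).differentiable two_ne_zero
    have e1 := congrFun (dirDeriv_sum Finset.univ (spaceDir i)
      fun j _ => (hU1 i (spaceDir j) (spaceDir j)).differentiable one_ne_zero) (x, τ)
    rw [hN i, pd3_slice ((d1.fun_sub d2).fun_sub d3)]
    have e2 (j : Fin 3) :
        dirDeriv (spaceDir j) (dirDeriv (spaceDir j) (dirDeriv (spaceDir i) (U i))) =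
        dirDeriv (spaceDir i) (dirDeriv (spaceDir j) (dirDeriv (spaceDir j) (U i))) := by
      rw [dirDeriv_comm ((hU i).of_le (by norm_num)) (spaceDir j) (spaceDir i),
        dirDeriv_comm (hU2 i _) (spaceDir j) (spaceDir i)]
    simp only [e2]
    rw [dirDeriv_comm ((hU i).of_le (by norm_num)) (0, 1) (spaceDir i), ← e1,
      dirDeriv_sub _ (d1.fun_sub d2) d3, dirDeriv_sub _ d1 d2,
      dirDeriv_const_mul _ ((hU2 i _).differentiable two_ne_zero)]
  have hlapp : lap3 (fun y => p y τ) x = _ := lap3_slice (hp_reg.of_le (by norm_num)) x τ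
  rw [hptt, hlapp, hlapdiv]
  have hdivsum := Finset.sum_congr rfl fun i (_ : i ∈ Finset.univ) => hdivN i
  rw [div3, hdivsum, Finset.sum_comm, Finset.sum_sub_distrib, Finset.sum_sub_distrib,
    ← Finset.mul_sum]
  ring
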